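/- For any multi-index I supported in Λ_- and any real φ, the reflection-symmetric combination of X = e^{iφ} C_I ϑ(C_I) with its reflection ϑ(X) = e^{−iφ} ϑ(C_I) C_I is a real multiple of ω^{|I|²/2} C_I ϑ(C_I); explicitly, e^{iφ} C_I ϑ(C_I) + e^{−iφ} ϑ(C_I) C_I = 2 cos(φ − π|I|²/n) · ω^{|I|²/2} C_I ϑ(C_I). -/

import Mathlib

open Matrix

/-- The primitive n-th root of unity `ω = exp(2πi/n)`. -/
noncomputable def pfOmega (n : ℕ) : ℂ := Complex.exp (2 * Real.pi * Complex.I / n)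

/-- `ω^{m/2} = exp(πim/n)`, the canonical square root of `ω^m`. -/
noncomputable def pfHalf (n : ℕ) (m : ℤ) : ℂ := Complex.exp (Real.pi * Complex.I * m / n)

/-- The ordered monomial `C_I = c 0 ^ I 0 * c 1 ^ I 1 * ⋯ * c (L-1) ^ I (L-1)`. -/
noncomputable def pfMonomial {L N : ℕ} (c : Fin L → Matrix (Fin N) (Fin N) ℂ)
    (I : Fin L → ℕ) : Matrix (Fin N) (Fin N) ℂ :=
  (List.ofFn fun j => c j ^ I j).prod

/-- `I ∘ I' = Σ_{j < j'} I j * I' j'`. -/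
def pfCirc {k : ℕ} (I I' : Fin k → ℕ) : ℕ :=
  ∑ j : Fin k, ∑ j' : Fin k, if j < j' then I j * I' j' else 0

/-- Total degree `|I| = Σ_j I j`. -/
def pfDeg {k : ℕ} (I : Fin k → ℕ) : ℕ := ∑ j, I j

/-- The complement multi-index `I^c = ((n - I j) mod n)_j`. -/
def pfComp (n : ℕ) {L : ℕ} (I : Fin L → ℕ) : Fin L → ℕ := fun j => (n - I j) % n

/-- The reflected multi-index `ϑI`, reversing the order of the entries. -/
def pfThetaIdx {L : ℕ} (I : Fin L → ℕ) : Fin L → ℕ := fun j => I j.rev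

/-- The reflected monomial `ϑ(C_I) = ω^{-I∘I} C_{ϑ(I^c)}`. -/
noncomputable def pfRefl (n : ℕ) {L N : ℕ} (c : Fin L → Matrix (Fin N) (Fin N) ℂ)
    (I : Fin L → ℕ) : Matrix (Fin N) (Fin N) ℂ :=
  pfOmega n ^ (-(pfCirc I I : ℤ)) • pfMonomial c (pfThetaIdx (pfComp n I))

/-- `c` is a family of parafermion generators of order `n`:
each `c j` is unitary, `c j ^ n = 1`, and `c j * c j' = ω • (c j' * c j)` for `j < j'`. -/
def IsParafermion (n : ℕ) {L N : ℕ} (c : Fin L → Matrix (Fin N) (Fin N) ℂ) : Prop :=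
  (∀ j, (c j)ᴴ * c j = 1 ∧ c j * (c j)ᴴ = 1) ∧
  (∀ j, c j ^ n = 1) ∧
  (∀ j j' : Fin L, j < j' → c j * c j' = pfOmega n • (c j' * c j))

/-- `I` is supported in `Λ₋ = {0, …, L/2 - 1}` (sites `1, …, L/2` in 1-based labels). -/
def pfSuppNeg {L : ℕ} (I : Fin L → ℕ) : Prop := ∀ j : Fin L, L / 2 ≤ j.val → I j = 0

/-- `I` is supported in `Λ₊ = {L/2, …, L-1}` (sites `L/2 + 1, …, L` in 1-based labels). -/
def pfSuppPos {L : ℕ} (I : Fin L → ℕ) : Prop := ∀ j : Fin L, j.val < L / 2 → I j = 0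

/-- The element `Σ_I a_I C_I` determined by a coefficient function `a`. -/
noncomputable def pfSum {L N : ℕ} (n : ℕ) (c : Fin L → Matrix (Fin N) (Fin N) ℂ)
    (a : (Fin L → Fin n) → ℂ) : Matrix (Fin N) (Fin N) ℂ :=
  ∑ I : Fin L → Fin n, a I • pfMonomial c fun j => (I j : ℕ)

/-- The reflection `ϑ(Σ_I a_I C_I) = Σ_I conj (a_I) ϑ(C_I)`. -/
noncomputable def pfSumRefl {L N : ℕ} (n : ℕ) (c : Fin L → Matrix (Fin N) (Fin N) ℂ)
    (a : (Fin L → Fin n) → ℂ) : Matrix (Fin N) (Fin N) ℂ :=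
  ∑ I : Fin L → Fin n, (starRingEnd ℂ) (a I) • pfRefl n c fun j => (I j : ℕ)

/-- Coefficients of an element of the observable algebra `𝔄₋ⁿ`: supported on
multi-indices supported in `Λ₋` with total degree divisible by `n`. -/
def pfObsNegCoeff {L : ℕ} (n : ℕ) (a : (Fin L → Fin n) → ℂ) : Prop :=
  ∀ I : Fin L → Fin n,
    ¬ (pfSuppNeg (fun j => (I j : ℕ)) ∧ n ∣ pfDeg (fun j => (I j : ℕ))) → a I = 0

/-- Coefficients of an element of the observable algebra `𝔄₊ⁿ`. -/
def pfObsPosCoeff {L : ℕ} (n : ℕ) (a : (Fin L → Fin n) → ℂ) : Prop :=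
  ∀ I : Fin L → Fin n,
    ¬ (pfSuppPos (fun j => (I j : ℕ)) ∧ n ∣ pfDeg (fun j => (I j : ℕ))) → a I = 0

/-- The cross-plane interaction
`H₀ = Σ_I (-1)^{|I|+1} ω^{|I|²/2} J_I C_I ϑ(C_I)` determined by couplings `J`. -/
noncomputable def pfH0 {L N : ℕ} (n : ℕ) (c : Fin L → Matrix (Fin N) (Fin N) ℂ)
    (J : (Fin L → Fin n) → ℝ) : Matrix (Fin N) (Fin N) ℂ :=
  ∑ I : Fin L → Fin n,
    ((-1 : ℂ) ^ (pfDeg (fun j => (I j : ℕ)) + 1) *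
        pfHalf n ((pfDeg (fun j => (I j : ℕ)) : ℤ) ^ 2) * (J I : ℂ)) •
      (pfMonomial c (fun j => (I j : ℕ)) * pfRefl n c fun j => (I j : ℕ))

/-- If each factor commutes with `b` up to a scalar, so does the product of the factors. -/
theorem prod_ofFn_mul_eq_smul {R A : Type*} [CommSemiring R] [Semiring A] [Algebra R A] {k : ℕ}
    (f : Fin k → A) (s : Fin k → R) (b : A) (h : ∀ j, f j * b = s j • (b * f j)) :
    (List.ofFn f).prod * b = (∏ j, s j) • (b * (List.ofFn f).prod) := by
  induction k with
  | zero => simp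
  | succ k ih =>
    rw [List.ofFn_succ, List.prod_cons, Fin.prod_univ_succ, mul_assoc,
      ih (fun j => f j.succ) (fun j => s j.succ) fun j => h j.succ, mul_smul_comm, ← mul_assoc,
      h 0, smul_mul_assoc, smul_smul, mul_assoc, mul_comm (s 0)]

/-- If each factor commutes with `b` up to a scalar, so does the product of the factors. -/
theorem mul_prod_ofFn_eq_smul {R A : Type*} [CommSemiring R] [Semiring A] [Algebra R A] {k : ℕ}
    (f : Fin k → A) (s : Fin k → R) (b : A) (h : ∀ j, b * f j = s j • (f j * b)) :
    b * (List.ofFn f).prod = (∏ j, s j) • ((List.ofFn f).prod * b) := by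
  induction k with
  | zero => simp
  | succ k ih =>
    rw [List.ofFn_succ, List.prod_cons, Fin.prod_univ_succ, ← mul_assoc, h 0, smul_mul_assoc,
      mul_assoc, ih (fun j => f j.succ) (fun j => s j.succ) fun j => h j.succ, mul_smul_comm,
      smul_smul, ← mul_assoc]

/-- Powers of elements commuting up to the scalar `s`. -/
theorem pow_mul_pow_eq_smul {R A : Type*} [CommSemiring R] [Semiring A] [Algebra R A]
    {s : R} {a b : A} (h : a * b = s • (b * a)) (p q : ℕ) :
    a ^ p * b ^ q = s ^ (p * q) • (b ^ q * a ^ p) := by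
  have hp : a ^ p * b = s ^ p • (b * a ^ p) := by
    simpa using prod_ofFn_mul_eq_smul (fun _ : Fin p => a) (fun _ => s) b fun _ => h
  simpa [pow_mul] using mul_prod_ofFn_eq_smul (fun _ : Fin q => b) (fun _ => s ^ p) (a ^ p)
    fun _ => hp

/-- `C_I C_J = ω^{|I||J|} C_J C_I` when the support of `I` lies to the left of that of `J`. -/
theorem IsParafermion.monomial_mul_monomial {n L N : ℕ} {c : Fin L → Matrix (Fin N) (Fin N) ℂ}
    (hc : IsParafermion n c) {I J : Fin L → ℕ} (hIJ : ∀ j k, I j ≠ 0 → J k ≠ 0 → j < k) :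
    pfMonomial c I * pfMonomial c J =
      pfOmega n ^ (pfDeg I * pfDeg J) • (pfMonomial c J * pfMonomial c I) := by
  have hpow (j k) : c j ^ I j * c k ^ J k =
      pfOmega n ^ (I j * J k) • (c k ^ J k * c j ^ I j) := by
    by_cases hj : I j = 0
    · simp [hj]
    by_cases hk : J k = 0
    · simp [hk]
    exact pow_mul_pow_eq_smul (hc.2.2 j k (hIJ j k hj hk)) _ _
  have hrow (j) : c j ^ I j * pfMonomial c J =
      pfOmega n ^ (I j * pfDeg J) • (pfMonomial c J * c j ^ I j) := by
    rw [pfMonomial, mul_prod_ofFn_eq_smul _ _ _ (hpow j), Finset.prod_pow_eq_pow_sum,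
      ← Finset.mul_sum, pfDeg]
  rw [pfMonomial, prod_ofFn_mul_eq_smul _ _ _ hrow, Finset.prod_pow_eq_pow_sum,
    ← Finset.sum_mul, ← pfDeg]

theorem pfSuppNeg.lt_of_ne_zero {n L : ℕ} (hL : Even L) {I : Fin L → ℕ} (hI : pfSuppNeg I)
    {j k : Fin L} (hj : I j ≠ 0) (hk : pfThetaIdx (pfComp n I) k ≠ 0) : j < k := by
  have hj' : j.val < L / 2 := by
    by_contra! h
    exact hj (hI j h)
  have hk' : k.rev.val < L / 2 := by
    by_contra! h
    exact hk (by simp [pfThetaIdx, pfComp, hI k.rev h])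
  rw [Fin.val_rev] at hk'
  rw [Fin.lt_def]
  obtain ⟨m, rfl⟩ := hL
  omega

theorem dvd_pfDeg_add_pfDeg_theta_comp {n L : ℕ} {I : Fin L → ℕ} (hI : ∀ j, I j < n) :
    n ∣ pfDeg I + pfDeg (pfThetaIdx (pfComp n I)) := by
  have h : pfDeg (pfThetaIdx (pfComp n I)) = pfDeg (pfComp n I) :=
    Equiv.sum_comp Fin.revPerm (pfComp n I)
  rw [h, pfDeg, pfDeg, ← Finset.sum_add_distrib]
  refine Finset.dvd_sum fun j _ => ?_
  rw [pfComp, Nat.dvd_iff_mod_eq_zero, Nat.add_mod_mod, Nat.add_sub_cancel' (hI j).le,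
    Nat.mod_self]

theorem pfOmega_pow_self {n : ℕ} (hn : n ≠ 0) : pfOmega n ^ n = 1 :=
  (Complex.isPrimitiveRoot_exp n hn).pow_eq_one

theorem pfHalf_mul_self (n m : ℕ) : pfHalf n m * pfHalf n m = pfOmega n ^ m := by
  rw [pfHalf, pfOmega, ← Complex.exp_add, ← Complex.exp_nat_mul]
  congr 1
  push_cast
  ring

/-- `ϑ(C_I) C_I = ω^{|I|²} C_I ϑ(C_I)` for `I` supported in `Λ₋`. -/
theorem IsParafermion.refl_mul_monomial {n L N : ℕ} (hn : n ≠ 0) (hL : Even L)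
    {c : Fin L → Matrix (Fin N) (Fin N) ℂ} (hc : IsParafermion n c) {I : Fin L → ℕ}
    (hI : ∀ j, I j < n) (hm : pfSuppNeg I) :
    pfRefl n c I * pfMonomial c I =
      pfOmega n ^ (pfDeg I ^ 2) • (pfMonomial c I * pfRefl n c I) := by
  obtain ⟨d, hd⟩ := dvd_pfDeg_add_pfDeg_theta_comp hI
  have hone : pfOmega n ^ (pfDeg I ^ 2) *
      pfOmega n ^ (pfDeg I * pfDeg (pfThetaIdx (pfComp n I))) = 1 := by
    rw [← pow_add, sq, ← mul_add, hd, mul_left_comm, pow_mul, pfOmega_pow_self hn, one_pow]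
  rw [pfRefl, mul_smul_comm, smul_mul_assoc,
    hc.monomial_mul_monomial fun _ _ => hm.lt_of_ne_zero hL, smul_comm (_ ^ (pfDeg I ^ 2)),
    smul_smul (_ ^ (pfDeg I ^ 2)), hone, one_smul]

/-- for `I` supported in `Λ₋` and real `φ`,
`e^{iφ} C_I ϑ(C_I) + e^{-iφ} ϑ(C_I) C_I
  = 2 cos(φ - π|I|²/n) · ω^{|I|²/2} C_I ϑ(C_I)`. -/
theorem stmt_7 (n L N : ℕ) (hn : 2 ≤ n) (hL : 2 ≤ L) (hLeven : Even L) (hN : 1 ≤ N)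
    (c : Fin L → Matrix (Fin N) (Fin N) ℂ) (hc : IsParafermion n c)
    (I : Fin L → ℕ) (hI : ∀ j, I j < n) (hm : pfSuppNeg I) (φ : ℝ) :
    Complex.exp (φ * Complex.I) • (pfMonomial c I * pfRefl n c I) +
        Complex.exp (-φ * Complex.I) • (pfRefl n c I * pfMonomial c I)
      = ((2 * Real.cos (φ - Real.pi * (pfDeg I : ℝ) ^ 2 / n) : ℝ) : ℂ) •
          (pfHalf n ((pfDeg I : ℤ) ^ 2) • (pfMonomial c I * pfRefl n c I)) := by
  have hhalf : pfHalf n ((pfDeg I : ℤ) ^ 2) =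
      Complex.exp ((Real.pi * (pfDeg I : ℝ) ^ 2 / n : ℝ) * Complex.I) := by
    rw [pfHalf]
    congr 1
    push_cast
    ring
  have hsq : pfOmega n ^ (pfDeg I ^ 2) =
      pfHalf n ((pfDeg I : ℤ) ^ 2) * pfHalf n ((pfDeg I : ℤ) ^ 2) := by
    rw [← pfHalf_mul_self]
    push_cast
    rfl
  rw [hc.refl_mul_monomial (by omega) hLeven hI hm, smul_smul, smul_smul, ← add_smul, hsq, hhalf]
  congr 1
  rw [Complex.ofReal_mul, Complex.ofReal_cos, Complex.ofReal_ofNat, Complex.two_cos, add_mul,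
    ← Complex.exp_add, ← Complex.exp_add, ← Complex.exp_add, ← Complex.exp_add]
  congr 2 <;> push_cast <;> ring
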